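/- arXiv:1312.1492 — 2 statements merged into one kernel-verified Lean document; each statement's English description precedes it below -/
import Mathlib

section
/- Let ε ≥ 0 and let k ≥ 1 deaths d₁, …, d_k be real numbers with 0 < dmin ≤ dᵢ ≤ dmax for all i, where dmin = min dᵢ and dmax = max dᵢ, and assume dmin > dmax/2 + 4ε. Let D be a finite set of points of ℝ² (with the sup distance) that splits as a disjoint union D = D' ∪ D'' such that there is a bijection φ from {1,…,k} to D' with dist(φ(i), (0, dᵢ)) ≤ ε for every i, and every point p ∈ D'' satisfies dist(p, (t,t)) ≤ ε for some real t. Set M = max over p = (x,y) ∈ D of (y − x). Then D' = { (x,y) ∈ D : y − x > M/2 }; in particular the number of points (x,y) of D with y − x > M/2 equals k. -/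
/-- Moving a point by at most `ε` in the sup distance changes `y - x` by at most `2 * ε`. -/
theorem abs_snd_sub_fst_sub_le {p q : ℝ × ℝ} {ε : ℝ} (h : dist p q ≤ ε) :
    |(p.2 - p.1) - (q.2 - q.1)| ≤ 2 * ε := by
  rw [Prod.dist_eq, max_le_iff, Real.dist_eq, Real.dist_eq, abs_le, abs_le] at h
  rw [abs_le]
  constructor <;> linarith [h.1.1, h.1.2, h.2.1, h.2.2]

/-- Points of the plane are pairs `(x, y) : ℝ × ℝ` with the sup distance
(which is the `dist` of the product metric in Mathlib). Given `ε ≥ 0`, `k ≥ 1` deaths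
`d i` with minimum `dmin > 0` and maximum `dmax` satisfying `dmin > dmax/2 + 4ε`,
a finite set `D` splitting as a disjoint union `D = D' ∪ D''`, a bijection `φ` from
`{1,…,k}` (modelled as `Fin k`) onto `D'` with `dist (φ i) (0, d i) ≤ ε`, and every
point of `D''` within `ε` of some diagonal point `(t, t)`, if `M` is the maximum of
`y - x` over `(x, y) ∈ D`, then `D' = {(x,y) ∈ D | y - x > M/2}` and in particular
that set has exactly `k` points. -/
theorem hole_count_recovery
    (ε : ℝ) (hε : 0 ≤ ε) (k : ℕ) (hk : 1 ≤ k)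
    (d : Fin k → ℝ) (dmin dmax : ℝ)
    (hdmin : IsLeast (Set.range d) dmin)
    (hdmax : IsGreatest (Set.range d) dmax)
    (hdminpos : 0 < dmin)
    (hgap : dmin > dmax / 2 + 4 * ε)
    (D D' D'' : Set (ℝ × ℝ)) (hDfin : D.Finite)
    (hunion : D = D' ∪ D'') (hdisj : Disjoint D' D'')
    (φ : Fin k → ℝ × ℝ) (hφ : Set.BijOn φ Set.univ D')
    (hφε : ∀ i : Fin k, dist (φ i) ((0 : ℝ), d i) ≤ ε)
    (hD'' : ∀ p ∈ D'', ∃ t : ℝ, dist p ((t, t) : ℝ × ℝ) ≤ ε)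
    (M : ℝ) (hM : IsGreatest ((fun p : ℝ × ℝ => p.2 - p.1) '' D) M) :
    D' = {p ∈ D | p.2 - p.1 > M / 2} ∧
      {p ∈ D | p.2 - p.1 > M / 2}.ncard = k := by
  have hpers (i : Fin k) : |((φ i).2 - (φ i).1) - d i| ≤ 2 * ε := by
    simpa using abs_snd_sub_fst_sub_le (hφε i)
  have hdiag : ∀ p ∈ D'', p.2 - p.1 ≤ 2 * ε := by
    intro p hp
    obtain ⟨t, ht⟩ := hD'' p hp
    have h := (abs_le.mp (abs_snd_sub_fst_sub_le ht)).2
    simpa using h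
  have hdmin_le (i : Fin k) : dmin ≤ d i := hdmin.2 ⟨i, rfl⟩
  have hle_dmax (i : Fin k) : d i ≤ dmax := hdmax.2 ⟨i, rfl⟩
  obtain ⟨j, hj⟩ := hdmax.1
  have hM_lower : dmax - 2 * ε ≤ M := by
    have hjD : φ j ∈ D := hunion ▸ Or.inl (hφ.mapsTo (Set.mem_univ j))
    have hjM : (φ j).2 - (φ j).1 ≤ M := hM.2 ⟨φ j, hjD, rfl⟩
    linarith [(abs_le.mp (hpers j)).1]
  have hM_upper : M ≤ dmax + 2 * ε := by
    obtain ⟨p, hpD, rfl⟩ := hM.1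
    rw [hunion] at hpD
    rcases hpD with hp | hp
    · obtain ⟨i, -, rfl⟩ := hφ.surjOn hp
      linarith [(abs_le.mp (hpers i)).2, hle_dmax i]
    · linarith [hdiag p hp, hdmin_le j]
  have hD' : D' = {p ∈ D | p.2 - p.1 > M / 2} := by
    ext p
    constructor
    · intro hp
      refine ⟨hunion ▸ Or.inl hp, ?_⟩
      obtain ⟨i, -, rfl⟩ := hφ.surjOn hp
      linarith [(abs_le.mp (hpers i)).1, hdmin_le i]
    · rintro ⟨hpD, hp⟩
      rw [hunion] at hpD
      refine hpD.resolve_right fun hp'' => ?_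
      linarith [hdiag p hp'', hdmin_le j]
  refine ⟨hD', ?_⟩
  rw [← hD', ← hφ.image_eq, hφ.injOn.ncard_image, Set.ncard_univ, Nat.card_fin]
end

section
/- Let ε ≥ 0, and let dmin, dmax be reals with 0 < dmin ≤ dmax and dmin > dmax/2 + 4ε. Let D, D', D'', φ, and M be as follows: D ⊆ ℝ² is finite, D = D' ∪ D'' disjointly, φ is a bijection from {1,…,k} to D' with dist(φ(i), (0, dᵢ)) ≤ ε in the sup distance where dmin ≤ dᵢ ≤ dmax, every p ∈ D'' is within sup distance ε of some diagonal point (t,t), and M = max over (x,y) ∈ D of (y − x). Then dmax − 2ε ≤ M ≤ dmax + 2ε, and 2ε < M/2 < dmin − 2ε. -/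
/-- The map `(x, y) ↦ y - x` is `2`-Lipschitz for the sup distance. -/
theorem abs_persistence_sub_le (p q : ℝ × ℝ) :
    |(p.2 - p.1) - (q.2 - q.1)| ≤ 2 * dist p q := by
  have h₁ : |p.1 - q.1| ≤ dist p q := le_max_left (dist p.1 q.1) (dist p.2 q.2)
  have h₂ : |p.2 - q.2| ≤ dist p q := le_max_right (dist p.1 q.1) (dist p.2 q.2)
  rw [abs_le] at *
  constructor <;> linarith


/-- With the same setup as STATEMENT 0 (points of `ℝ × ℝ` with the sup
distance, `ε ≥ 0`, `0 < dmin ≤ dmax` with `dmin > dmax/2 + 4ε`, `dmin` and `dmax`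
the min and max of the deaths `d i`, a finite set `D = D' ∪ D''` split disjointly,
`φ` a bijection from `{1,…,k}` onto `D'` with `dist (φ i) (0, d i) ≤ ε`, every point
of `D''` within `ε` of the diagonal, and `M` the maximum of `y - x` over `D`),
one has `dmax - 2ε ≤ M ≤ dmax + 2ε` and `2ε < M/2 < dmin - 2ε`. -/
theorem max_persistence_bounds
    (ε : ℝ) (hε : 0 ≤ ε) (k : ℕ) (hk : 1 ≤ k)
    (d : Fin k → ℝ) (dmin dmax : ℝ)
    (hdmin : IsLeast (Set.range d) dmin)
    (hdmax : IsGreatest (Set.range d) dmax)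
    (hdminpos : 0 < dmin) (hle : dmin ≤ dmax)
    (hgap : dmin > dmax / 2 + 4 * ε)
    (D D' D'' : Set (ℝ × ℝ)) (hDfin : D.Finite)
    (hunion : D = D' ∪ D'') (hdisj : Disjoint D' D'')
    (φ : Fin k → ℝ × ℝ) (hφ : Set.BijOn φ Set.univ D')
    (hφε : ∀ i : Fin k, dist (φ i) ((0 : ℝ), d i) ≤ ε)
    (hD'' : ∀ p ∈ D'', ∃ t : ℝ, dist p ((t, t) : ℝ × ℝ) ≤ ε)
    (M : ℝ) (hM : IsGreatest ((fun p : ℝ × ℝ => p.2 - p.1) '' D) M) :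
    dmax - 2 * ε ≤ M ∧ M ≤ dmax + 2 * ε ∧
      2 * ε < M / 2 ∧ M / 2 < dmin - 2 * ε := by
  have hlower : dmax - 2 * ε ≤ M := by
    obtain ⟨i, rfl⟩ := hdmax.1
    have hmem : φ i ∈ D := hunion ▸ Or.inl (hφ.mapsTo (Set.mem_univ i))
    have hle_M : (φ i).2 - (φ i).1 ≤ M := hM.2 ⟨φ i, hmem, rfl⟩
    have h := (abs_le.mp (abs_persistence_sub_le (φ i) (0, d i))).1
    dsimp only at h
    linarith [hφε i]
  have hupper : M ≤ dmax + 2 * ε := by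
    obtain ⟨p, hp, rfl⟩ := hM.1
    dsimp only
    rw [hunion] at hp
    rcases hp with hp | hp
    · obtain ⟨i, -, rfl⟩ := hφ.surjOn hp
      have h := (abs_le.mp (abs_persistence_sub_le (φ i) (0, d i))).2
      dsimp only at h
      linarith [hφε i, hdmax.2 ⟨i, rfl⟩]
    · obtain ⟨t, ht⟩ := hD'' p hp
      have h := (abs_le.mp (abs_persistence_sub_le p (t, t))).2
      dsimp only at h
      linarith
  refine ⟨hlower, hupper, ?_, ?_⟩ <;> linarith
end
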